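/- arXiv:1903.03690 — 3 statements merged into one kernel-verified Lean document; each statement's English description precedes it below -/
import Mathlib

section
/- The efficient influence curve has mean zero: E_P[D*(P)] = 0; moreover each component has mean zero separately, E_P[D_Y] = 0, E_P[D_Z] = 0, and E_P[D_W] = 0. -/
open MeasureTheory

noncomputable section

/-- Discrete transported-mediation setup: a probability space `(Ω, P)` carrying
binary random variables `S, A, Z, M`, a covariate `W` valued in a nonempty finite
set `𝒲`, and an outcome `Y` valued in a nonempty finite set `ySet ⊆ ℝ`, with
strong positivity of every joint cell. -/
structure TransportSetup (Ω : Type*) [MeasurableSpace Ω]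
    (𝒲 : Type*) [MeasurableSpace 𝒲] [MeasurableSingletonClass 𝒲]
    [Fintype 𝒲] [Nonempty 𝒲] where
  P : Measure Ω
  isProb : IsProbabilityMeasure P
  S : Ω → Fin 2
  A : Ω → Fin 2
  Z : Ω → Fin 2
  M : Ω → Fin 2
  W : Ω → 𝒲
  Y : Ω → ℝ
  ySet : Finset ℝ
  ySet_nonempty : ySet.Nonempty
  hY : ∀ ω, Y ω ∈ ySet
  measS : Measurable S
  measA : Measurable A
  measZ : Measurable Z
  measM : Measurable M
  measW : Measurable W
  measY : Measurable Y
  positivity : ∀ (s' x z m : Fin 2) (w : 𝒲), ∀ y ∈ ySet,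
    0 < P {ω | S ω = s' ∧ W ω = w ∧ A ω = x ∧ Z ω = z ∧ M ω = m ∧ Y ω = y}

namespace TransportSetup

variable {Ω : Type*} [MeasurableSpace Ω]
  {𝒲 : Type*} [MeasurableSpace 𝒲] [MeasurableSingletonClass 𝒲]
  [Fintype 𝒲] [Nonempty 𝒲]
variable (T : TransportSetup Ω 𝒲)

/-- Probability of an event, as a real number. -/
def pr (E : Set Ω) : ℝ := (T.P E).toReal

/-- Conditional probability `P(E | F)`. -/
def cpr (E F : Set Ω) : ℝ := T.pr (E ∩ F) / T.pr F

/-- Conditional expectation `E[f | F]` of a real random variable given an event. -/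
def cexp (f : Ω → ℝ) (F : Set Ω) : ℝ := (∫ ω in F, f ω ∂T.P) / T.pr F

/-- `Q̄_Y(m,z,x,w) = E[Y | M=m, Z=z, A=x, W=w, S=1]`. -/
def qbarY (m z x : Fin 2) (w : 𝒲) : ℝ :=
  T.cexp T.Y {ω | T.M ω = m ∧ T.Z ω = z ∧ T.A ω = x ∧ T.W ω = w ∧ T.S ω = 1}

/-- `P(Z=z | A=x, W=w, S=s)`. -/
def pZ (x z : Fin 2) (w : 𝒲) (s : Fin 2) : ℝ :=
  T.cpr {ω | T.Z ω = z} {ω | T.A ω = x ∧ T.W ω = w ∧ T.S ω = s}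

/-- `P(S=s | W=w)`. -/
def pSW (s : Fin 2) (w : 𝒲) : ℝ := T.cpr {ω | T.S ω = s} {ω | T.W ω = w}

/-- `P(M=m | Z=z, A=x, W=w, S=1)`. -/
def pM (m z x : Fin 2) (w : 𝒲) : ℝ :=
  T.cpr {ω | T.M ω = m} {ω | T.Z ω = z ∧ T.A ω = x ∧ T.W ω = w ∧ T.S ω = 1}

/-- `P(A=x | W=w, S=s)`. -/
def pA (x : Fin 2) (w : 𝒲) (s : Fin 2) : ℝ :=
  T.cpr {ω | T.A ω = x} {ω | T.W ω = w ∧ T.S ω = s}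

/-- `P(S=0)`. -/
def pS0 : ℝ := T.pr {ω | T.S ω = 0}

/-- `P(W=w | S=0)`. -/
def pWS0 (w : 𝒲) : ℝ := T.cpr {ω | T.W ω = w} {ω | T.S ω = 0}

/-- The transported estimand `Ψ(P)`. -/
def Psi (gs : Fin 2 → 𝒲 → ℝ) (a : Fin 2) : ℝ :=
  ∑ w : 𝒲, ∑ z : Fin 2, ∑ m : Fin 2,
    T.pWS0 w * T.pZ a z w 0 * gs m w * T.qbarY m z a w

/-- The transport-mediation weight `H`. -/
def Hwt (gs : Fin 2 → 𝒲 → ℝ) (a : Fin 2) (ω : Ω) : ℝ :=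
  (gs (T.M ω) (T.W ω) * T.pZ a (T.Z ω) (T.W ω) 0 * T.pSW 0 (T.W ω) *
    (if T.S ω = 1 ∧ T.A ω = a then (1 : ℝ) else 0)) /
  (T.pM (T.M ω) (T.Z ω) a (T.W ω) * T.pZ a (T.Z ω) (T.W ω) 1 * T.pA a (T.W ω) 1 *
    T.pSW 1 (T.W ω) * T.pS0)

/-- `Q̄_M(z,x,w) = Σ_m g*(m|w) Q̄_Y(m,z,x,w)`. -/
def qbarM (gs : Fin 2 → 𝒲 → ℝ) (z x : Fin 2) (w : 𝒲) : ℝ :=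
  ∑ m : Fin 2, gs m w * T.qbarY m z x w

/-- `Q̄_Z(w) = Σ_z P(Z=z|A=a,W=w,S=0) Q̄_M(z,a,w)`. -/
def qbarZ (gs : Fin 2 → 𝒲 → ℝ) (a : Fin 2) (w : 𝒲) : ℝ :=
  ∑ z : Fin 2, T.pZ a z w 0 * T.qbarM gs z a w

/-- `D_Y`, the `Y`-component of the (unrestricted-model) efficient influence curve. -/
def DY (gs : Fin 2 → 𝒲 → ℝ) (a : Fin 2) (ω : Ω) : ℝ :=
  (T.Y ω - T.qbarY (T.M ω) (T.Z ω) (T.A ω) (T.W ω)) * T.Hwt gs a ω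

/-- `D_Z`, the `Z`-component of the efficient influence curve. -/
def DZ (gs : Fin 2 → 𝒲 → ℝ) (a : Fin 2) (ω : Ω) : ℝ :=
  (T.qbarM gs (T.Z ω) a (T.W ω) - T.qbarZ gs a (T.W ω)) *
    (if T.S ω = 0 ∧ T.A ω = a then (1 : ℝ) else 0) / (T.pA a (T.W ω) 0 * T.pS0)

/-- `D_W`, the `W`-component of the efficient influence curve. -/
def DW (gs : Fin 2 → 𝒲 → ℝ) (a : Fin 2) (ω : Ω) : ℝ :=
  (T.qbarZ gs a (T.W ω) - T.Psi gs a) *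
    (if T.S ω = 0 then (1 : ℝ) else 0) / T.pS0


end TransportSetup

namespace TransportSetup

variable {Ω : Type*} [MeasurableSpace Ω]
  {𝒲 : Type*} [MeasurableSpace 𝒲] [MeasurableSingletonClass 𝒲]
  [Fintype 𝒲] [Nonempty 𝒲]
variable (T : TransportSetup Ω 𝒲)

lemma aux_int {β : Type*} [Fintype β] [MeasurableSpace β] [MeasurableSingletonClass β]
    {X : Ω → β} (hX : Measurable X) (F : β → ℝ) : Integrable (fun ω => F (X ω)) T.P := by
  have := T.isProb
  have := Measure.isProbabilityMeasure_map (μ := T.P) hX.aemeasurable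
  exact (Integrable.of_finite (f := F) (μ := T.P.map X)).comp_measurable hX

lemma aux_sum {β : Type*} [Fintype β] [MeasurableSpace β] [MeasurableSingletonClass β]
    {X : Ω → β} (hX : Measurable X) (f : Ω → ℝ) (hf : Integrable f T.P) :
    ∫ ω, f ω ∂T.P = ∑ b, ∫ ω in X ⁻¹' {b}, f ω ∂T.P := by
  rw [← integral_iUnion_fintype (fun b => hX (measurableSet_singleton b))
    (fun i j hij => Disjoint.preimage _ (by simpa using hij)) (fun _ => hf.integrableOn)]
  have : (⋃ b, X ⁻¹' {b}) = Set.univ := by ext ω; simp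
  rw [this, setIntegral_univ]

lemma aux_fin {β : Type*} [Fintype β] [MeasurableSpace β] [MeasurableSingletonClass β]
    {X : Ω → β} (hX : Measurable X) (F : β → ℝ) :
    ∫ ω, F (X ω) ∂T.P = ∑ b, T.pr (X ⁻¹' {b}) * F b := by
  have := T.isProb
  rw [T.aux_sum hX _ (T.aux_int hX F)]
  refine Finset.sum_congr rfl fun b _ => ?_
  rw [setIntegral_congr_fun (g := fun _ => F b) (hX (measurableSet_singleton b))
    (fun ω hω => by simp only [Set.mem_preimage, Set.mem_singleton_iff] at hω; simp [hω])]
  simp [pr, Measure.real]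

lemma aux_pos (E : Set Ω) (s x z m : Fin 2) (w : 𝒲)
    (h : ∀ ω, T.S ω = s → T.A ω = x → T.Z ω = z → T.M ω = m → T.W ω = w → ω ∈ E) :
    0 < T.pr E := by
  have := T.isProb
  obtain ⟨y, hy⟩ := T.ySet_nonempty
  refine ENNReal.toReal_pos ?_ (measure_ne_top _ _)
  refine ((T.positivity s x z m w y hy).trans_le (measure_mono ?_)).ne'
  rintro ω ⟨h1, h2, h3, h4, h5, -⟩
  exact h ω h1 h3 h4 h5 h2

lemma aux_Y : Integrable T.Y T.P := by
  have := T.isProb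
  refine Integrable.of_bound T.measY.aestronglyMeasurable (∑ y ∈ T.ySet, ‖y‖) ?_
  exact Filter.Eventually.of_forall fun ω =>
    Finset.single_le_sum (f := fun y : ℝ => ‖y‖) (fun _ _ => norm_nonneg _) (T.hY ω)

lemma aux_split {β : Type*} [Fintype β] [MeasurableSpace β] [MeasurableSingletonClass β]
    {X : Ω → β} (hX : Measurable X) (F : Set Ω) (hF : MeasurableSet F) :
    ∑ b, T.pr ({ω | X ω = b} ∩ F) = T.pr F := by
  have := T.isProb
  have h := T.aux_sum hX (F.indicator fun _ => (1:ℝ)) ((integrable_const _).indicator hF)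
  rw [integral_indicator hF] at h
  simp only [integral_indicator hF, Measure.restrict_restrict hF] at h
  simp only [integral_const, smul_eq_mul, mul_one, Measure.real, Measure.restrict_apply_univ] at h
  unfold pr
  rw [h]
  refine Finset.sum_congr rfl fun b _ => ?_
  rw [Set.inter_comm]; rfl

lemma aux_DW (gs : Fin 2 → 𝒲 → ℝ) (a : Fin 2) :
    Integrable (T.DW gs a) T.P ∧ ∫ ω, T.DW gs a ω ∂T.P = 0 := by
  have hX : Measurable fun ω => (T.W ω, T.S ω) := T.measW.prodMk T.measS
  let F : 𝒲 × Fin 2 → ℝ := fun p => (T.qbarZ gs a p.1 - T.Psi gs a) *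
    (if p.2 = 0 then (1 : ℝ) else 0) / T.pS0
  refine ⟨T.aux_int hX F, (T.aux_fin hX F).trans ?_⟩
  obtain ⟨w0⟩ := ‹Nonempty 𝒲›
  have h0 : T.pS0 ≠ 0 := (T.aux_pos {ω | T.S ω = 0} 0 0 0 0 w0 (by simp +contextual)).ne'
  have hS : MeasurableSet {ω | T.S ω = 0} := T.measS (measurableSet_singleton 0)
  have h1 : ∑ w, T.pWS0 w = 1 := by
    simp only [pWS0, cpr, ← Finset.sum_div]
    rw [T.aux_split T.measW _ hS]
    exact div_self h0
  have h2 : T.Psi gs a = ∑ w, T.pWS0 w * T.qbarZ gs a w := by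
    simp only [Psi, qbarZ, qbarM, Finset.mul_sum, mul_assoc]
  have h3 : ∀ w, T.pr ((fun ω => (T.W ω, T.S ω)) ⁻¹' {(w, 0)}) = T.pWS0 w * T.pS0 := by
    intro w
    rw [pWS0, cpr, ← pS0, div_mul_cancel₀ _ h0]
    congr 1; ext ω; simp
  rw [Fintype.sum_prod_type]
  simp only [Fin.sum_univ_two, F, h3]
  simp only [if_true, one_ne_zero, if_false, mul_zero, zero_div, add_zero, mul_one]
  have : ∀ w, T.pWS0 w * T.pS0 * ((T.qbarZ gs a w - T.Psi gs a) / T.pS0)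
      = T.pWS0 w * T.qbarZ gs a w - T.pWS0 w * T.Psi gs a := by
    intro w; field_simp
  simp only [this]
  rw [Finset.sum_sub_distrib, ← h2, ← Finset.sum_mul, h1]; ring

lemma aux_DZ (gs : Fin 2 → 𝒲 → ℝ) (a : Fin 2) :
    Integrable (T.DZ gs a) T.P ∧ ∫ ω, T.DZ gs a ω ∂T.P = 0 := by
  classical
  have hX : Measurable fun ω => (T.W ω, (T.S ω, T.A ω), T.Z ω) :=
    T.measW.prodMk ((T.measS.prodMk T.measA).prodMk T.measZ)
  let F : 𝒲 × (Fin 2 × Fin 2) × Fin 2 → ℝ := fun p =>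
    (T.qbarM gs p.2.2 a p.1 - T.qbarZ gs a p.1) *
    (if p.2.1.1 = 0 ∧ p.2.1.2 = a then (1 : ℝ) else 0) / (T.pA a p.1 0 * T.pS0)
  refine ⟨T.aux_int hX F, (T.aux_fin hX F).trans ?_⟩
  rw [Fintype.sum_prod_type]
  refine Finset.sum_eq_zero fun w _ => ?_
  rw [Fintype.sum_prod_type]
  refine Finset.sum_eq_zero fun sx _ => ?_
  obtain ⟨s, x⟩ := sx
  by_cases hsx : s = 0 ∧ x = a
  swap
  · simp [F, hsx]
  obtain ⟨rfl, rfl⟩ := hsx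
  set E : Set Ω := {ω | T.A ω = x ∧ T.W ω = w ∧ T.S ω = 0} with hEdef
  have hE : MeasurableSet E :=
    (T.measA (measurableSet_singleton x)).inter
      ((T.measW (measurableSet_singleton w)).inter (T.measS (measurableSet_singleton 0)))
  have h0 : T.pr E ≠ 0 := (T.aux_pos E 0 x 0 0 w (by simp +contextual [E])).ne'
  have h1 : ∑ z, T.pZ x z w 0 = 1 := by
    simp only [pZ, cpr, ← Finset.sum_div]
    rw [T.aux_split T.measZ _ hE]
    exact div_self h0
  have h3 : ∀ z, T.pr ((fun ω => (T.W ω, (T.S ω, T.A ω), T.Z ω)) ⁻¹' {(w, (0, x), z)})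
      = T.pZ x z w 0 * T.pr E := by
    intro z
    rw [pZ, cpr, ← hEdef, div_mul_cancel₀ _ h0]
    congr 1; ext ω; simp [E]; tauto
  simp only [h3, F, and_self, if_true, mul_one]
  have : ∀ z, T.pZ x z w 0 * T.pr E *
      ((T.qbarM gs z x w - T.qbarZ gs x w) / (T.pA x w 0 * T.pS0))
      = (T.pZ x z w 0 * T.qbarM gs z x w - T.pZ x z w 0 * T.qbarZ gs x w) *
        (T.pr E / (T.pA x w 0 * T.pS0)) := by
    intro z; ring
  simp only [this]
  rw [← Finset.sum_mul, Finset.sum_sub_distrib, ← Finset.sum_mul, h1]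
  simp [qbarZ]

lemma aux_DY (gs : Fin 2 → 𝒲 → ℝ) (a : Fin 2) :
    Integrable (T.DY gs a) T.P ∧ ∫ ω, T.DY gs a ω ∂T.P = 0 := by
  classical
  have := T.isProb
  have hX : Measurable fun ω => (T.M ω, T.Z ω, T.A ω, T.W ω, T.S ω) :=
    T.measM.prodMk (T.measZ.prodMk (T.measA.prodMk (T.measW.prodMk T.measS)))
  let G : Fin 2 × Fin 2 × Fin 2 × 𝒲 × Fin 2 → ℝ := fun p =>
    T.qbarY p.1 p.2.1 p.2.2.1 p.2.2.2.1
  let H : Fin 2 × Fin 2 × Fin 2 × 𝒲 × Fin 2 → ℝ := fun p =>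
    (gs p.1 p.2.2.2.1 * T.pZ a p.2.1 p.2.2.2.1 0 * T.pSW 0 p.2.2.2.1 *
    (if p.2.2.2.2 = 1 ∧ p.2.2.1 = a then (1 : ℝ) else 0)) /
    (T.pM p.1 p.2.1 a p.2.2.2.1 * T.pZ a p.2.1 p.2.2.2.1 1 * T.pA a p.2.2.2.1 1 *
    T.pSW 1 p.2.2.2.1 * T.pS0)
  have hi : Integrable (T.DY gs a) T.P := by
    have h1 := T.aux_Y.sub (T.aux_int hX G)
    refine h1.mul_bdd (c := ∑ p, ‖H p‖) (g := T.Hwt gs a) (T.aux_int hX H).aestronglyMeasurable ?_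
    exact Filter.Eventually.of_forall fun ω =>
      Finset.single_le_sum (f := fun p => ‖H p‖) (fun _ _ => norm_nonneg _)
        (Finset.mem_univ (T.M ω, T.Z ω, T.A ω, T.W ω, T.S ω))
  refine ⟨hi, (T.aux_sum hX _ hi).trans (Finset.sum_eq_zero fun p _ => ?_)⟩
  have hm := hX (measurableSet_singleton p)
  rw [setIntegral_congr_fun (g := fun ω => (T.Y ω - G p) * H p) hm
    (fun ω hω => by
      simp only [Set.mem_preimage, Set.mem_singleton_iff] at hω
      subst hω; rfl)]
  rw [integral_mul_const]
  obtain ⟨m, z, x, w, s⟩ := p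
  by_cases hs : s = 1
  swap
  · simp [H, hs]
  subst hs
  have hE : (fun ω => (T.M ω, T.Z ω, T.A ω, T.W ω, T.S ω)) ⁻¹' {(m, z, x, w, 1)}
    = {ω | T.M ω = m ∧ T.Z ω = z ∧ T.A ω = x ∧ T.W ω = w ∧ T.S ω = 1} := by
    ext ω; simp
  rw [hE]
  set E := {ω | T.M ω = m ∧ T.Z ω = z ∧ T.A ω = x ∧ T.W ω = w ∧ T.S ω = 1} with hEdef
  have h0 : T.pr E ≠ 0 := (T.aux_pos E 1 x z m w (by simp +contextual [E])).ne'
  rw [integral_sub T.aux_Y.integrableOn (integrable_const _)]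
  have : G (m, z, x, w, 1) = (∫ ω in E, T.Y ω ∂T.P) / T.pr E := rfl
  rw [this, integral_const, smul_eq_mul, Measure.real, Measure.restrict_apply_univ]
  change (_ - T.pr E * _) * _ = 0
  rw [mul_div_cancel₀ _ h0]; simp

end TransportSetup

/-- The efficient influence curve has mean zero:
`E_P[D*(P)] = 0`; moreover each component `D_Y`, `D_Z`, `D_W` has mean zero
separately. -/
theorem efficient_influence_curve_mean_zero
    {Ω : Type*} [MeasurableSpace Ω]
    {𝒲 : Type*} [MeasurableSpace 𝒲] [MeasurableSingletonClass 𝒲]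
    [Fintype 𝒲] [Nonempty 𝒲]
    (T : TransportSetup Ω 𝒲) (a : Fin 2)
    (gs : Fin 2 → 𝒲 → ℝ)
    (hgs_pos : ∀ (m : Fin 2) (w : 𝒲), 0 < gs m w ∧ gs m w < 1)
    (hgs_sum : ∀ w : 𝒲, gs 0 w + gs 1 w = 1) :
    (∫ ω, (T.DY gs a ω + T.DZ gs a ω + T.DW gs a ω) ∂T.P) = 0 ∧
    (∫ ω, T.DY gs a ω ∂T.P) = 0 ∧
    (∫ ω, T.DZ gs a ω ∂T.P) = 0 ∧
    (∫ ω, T.DW gs a ω ∂T.P) = 0 := by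
  obtain ⟨h1, e1⟩ := T.aux_DY gs a
  obtain ⟨h2, e2⟩ := T.aux_DZ gs a
  obtain ⟨h3, e3⟩ := T.aux_DW gs a
  refine ⟨?_, e1, e2, e3⟩
  refine (integral_add (h1.add h2) h3).trans ?_
  rw [integral_add' h1 h2, e1, e2, e3]
  simp
end
end

section
/- Define φ_Y(ε) := Σ_{w∈𝒲} Σ_{z,m∈{0,1}} Σ_{y∈𝒴} y · P_{p_ε}(Y=y | M=m, Z=z, A=a, W=w, S=1) · g*(m|w) · P_p(Z=z | A=a, W=w, S=0) · P_p(W=w | S=0), i.e. only the outcome-regression factor of the transported estimand is perturbed along the score path. Then φ_Y is differentiable at ε = 0 and φ_Y'(0) = Σ_{o∈𝒪} γ(o) · D_Y(o) · p(o), where D_Y is the Y-component of the efficient influence curve computed from p. -/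
open Finset

noncomputable section

/-- The finite outcome space `𝒪 := {0,1} × 𝒲 × {0,1} × {0,1} × {0,1} × 𝒴` for the
observed data `O = (S, W, A, Z, M, Y)`, where `𝒴` is a finite set of reals. -/
abbrev Obs (𝒲 : Type*) (Ys : Finset ℝ) : Type _ :=
  Fin 2 × 𝒲 × Fin 2 × Fin 2 × Fin 2 × {y : ℝ // y ∈ Ys}

namespace Obs

variable {𝒲 : Type*} {Ys : Finset ℝ}

/-- The site coordinate `S`. -/
def oS (o : Obs 𝒲 Ys) : Fin 2 := o.1
/-- The covariate coordinate `W`. -/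
def oW (o : Obs 𝒲 Ys) : 𝒲 := o.2.1
/-- The treatment coordinate `A`. -/
def oA (o : Obs 𝒲 Ys) : Fin 2 := o.2.2.1
/-- The intermediate-variable coordinate `Z`. -/
def oZ (o : Obs 𝒲 Ys) : Fin 2 := o.2.2.2.1
/-- The mediator coordinate `M`. -/
def oM (o : Obs 𝒲 Ys) : Fin 2 := o.2.2.2.2.1
/-- The outcome coordinate `Y`, as an element of `𝒴`. -/
def oYs (o : Obs 𝒲 Ys) : {y : ℝ // y ∈ Ys} := o.2.2.2.2.2
/-- The outcome coordinate `Y`, as a real number. -/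
def oY (o : Obs 𝒲 Ys) : ℝ := (o.2.2.2.2.2 : ℝ)

end Obs

namespace TransportPMF

open Obs

variable {𝒲 : Type*} [Fintype 𝒲] {Ys : Finset ℝ}

open scoped Classical in
/-- The probability of an event under a pmf `q`. -/
def prE (q : Obs 𝒲 Ys → ℝ) (E : Obs 𝒲 Ys → Prop) : ℝ :=
  ∑ o : Obs 𝒲 Ys, if E o then q o else 0

/-- Conditional probability `P_q(E | F)`. -/
def condP (q : Obs 𝒲 Ys → ℝ) (E F : Obs 𝒲 Ys → Prop) : ℝ :=
  prE q (fun o => E o ∧ F o) / prE q F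

open scoped Classical in
/-- Conditional expectation `E_q[Y | F]` of the outcome coordinate given an event. -/
def condEY (q : Obs 𝒲 Ys → ℝ) (F : Obs 𝒲 Ys → Prop) : ℝ :=
  (∑ o : Obs 𝒲 Ys, if F o then oY o * q o else 0) / prE q F

/-- `Q̄_Y(m,z,x,w) = E_q[Y | M=m, Z=z, A=x, W=w, S=1]`. -/
def qbarY (q : Obs 𝒲 Ys → ℝ) (m z x : Fin 2) (w : 𝒲) : ℝ :=
  condEY q (fun o => oM o = m ∧ oZ o = z ∧ oA o = x ∧ oW o = w ∧ oS o = 1)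

/-- `P_q(Z=z | A=x, W=w, S=s)`. -/
def pZ (q : Obs 𝒲 Ys → ℝ) (x z : Fin 2) (w : 𝒲) (s : Fin 2) : ℝ :=
  condP q (fun o => oZ o = z) (fun o => oA o = x ∧ oW o = w ∧ oS o = s)

/-- `P_q(S=s | W=w)`. -/
def pSW (q : Obs 𝒲 Ys → ℝ) (s : Fin 2) (w : 𝒲) : ℝ :=
  condP q (fun o => oS o = s) (fun o => oW o = w)

/-- `P_q(M=m | Z=z, A=x, W=w, S=1)`. -/
def pM (q : Obs 𝒲 Ys → ℝ) (m z x : Fin 2) (w : 𝒲) : ℝ :=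
  condP q (fun o => oM o = m) (fun o => oZ o = z ∧ oA o = x ∧ oW o = w ∧ oS o = 1)

/-- `P_q(A=x | W=w, S=s)`. -/
def pA (q : Obs 𝒲 Ys → ℝ) (x : Fin 2) (w : 𝒲) (s : Fin 2) : ℝ :=
  condP q (fun o => oA o = x) (fun o => oW o = w ∧ oS o = s)

/-- `P_q(S=0)`. -/
def pS0 (q : Obs 𝒲 Ys → ℝ) : ℝ := prE q (fun o => oS o = 0)

/-- `P_q(W=w | S=0)`. -/
def pWS0 (q : Obs 𝒲 Ys → ℝ) (w : 𝒲) : ℝ :=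
  condP q (fun o => oW o = w) (fun o => oS o = 0)

/-- The transported estimand `Ψ(q)`. -/
def Psi (q : Obs 𝒲 Ys → ℝ) (gs : Fin 2 → 𝒲 → ℝ) (a : Fin 2) : ℝ :=
  ∑ w : 𝒲, ∑ z : Fin 2, ∑ m : Fin 2,
    pWS0 q w * pZ q a z w 0 * gs m w * qbarY q m z a w

/-- The transport-mediation weight `H`, as a function on the outcome space. -/
def Hwt (q : Obs 𝒲 Ys → ℝ) (gs : Fin 2 → 𝒲 → ℝ) (a : Fin 2) (o : Obs 𝒲 Ys) : ℝ :=
  (gs (oM o) (oW o) * pZ q a (oZ o) (oW o) 0 * pSW q 0 (oW o) *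
    (if oS o = 1 ∧ oA o = a then (1 : ℝ) else 0)) /
  (pM q (oM o) (oZ o) a (oW o) * pZ q a (oZ o) (oW o) 1 * pA q a (oW o) 1 *
    pSW q 1 (oW o) * pS0 q)

/-- `Q̄_M(z,x,w) = Σ_m g*(m|w) Q̄_Y(m,z,x,w)`. -/
def qbarM (q : Obs 𝒲 Ys → ℝ) (gs : Fin 2 → 𝒲 → ℝ) (z x : Fin 2) (w : 𝒲) : ℝ :=
  ∑ m : Fin 2, gs m w * qbarY q m z x w

/-- `Q̄_Z(w) = Σ_z P_q(Z=z|A=a,W=w,S=0) Q̄_M(z,a,w)`. -/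
def qbarZ (q : Obs 𝒲 Ys → ℝ) (gs : Fin 2 → 𝒲 → ℝ) (a : Fin 2) (w : 𝒲) : ℝ :=
  ∑ z : Fin 2, pZ q a z w 0 * qbarM q gs z a w

/-- `D_Y`, the `Y`-component of the efficient influence curve, on the outcome space. -/
def DY (q : Obs 𝒲 Ys → ℝ) (gs : Fin 2 → 𝒲 → ℝ) (a : Fin 2) (o : Obs 𝒲 Ys) : ℝ :=
  (oY o - qbarY q (oM o) (oZ o) (oA o) (oW o)) * Hwt q gs a o

/-- `D_Z`, the `Z`-component of the efficient influence curve, on the outcome space. -/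
def DZ (q : Obs 𝒲 Ys → ℝ) (gs : Fin 2 → 𝒲 → ℝ) (a : Fin 2) (o : Obs 𝒲 Ys) : ℝ :=
  (qbarM q gs (oZ o) a (oW o) - qbarZ q gs a (oW o)) *
    (if oS o = 0 ∧ oA o = a then (1 : ℝ) else 0) / (pA q a (oW o) 0 * pS0 q)

/-- `D_W`, the `W`-component of the efficient influence curve, on the outcome space. -/
def DW (q : Obs 𝒲 Ys → ℝ) (gs : Fin 2 → 𝒲 → ℝ) (a : Fin 2) (o : Obs 𝒲 Ys) : ℝ :=
  (qbarZ q gs a (oW o) - Psi q gs a) *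
    (if oS o = 0 then (1 : ℝ) else 0) / pS0 q

/-- The score-path perturbation `p_ε(o) := (1 + ε·γ(o))·p(o)`. -/
def pert (p γ : Obs 𝒲 Ys → ℝ) (ε : ℝ) (o : Obs 𝒲 Ys) : ℝ := (1 + ε * γ o) * p o

end TransportPMF


namespace TransportPMF
open Obs

lemma aux_prE_pos {𝒲 : Type*} [Fintype 𝒲] {Ys : Finset ℝ} (p : Obs 𝒲 Ys → ℝ)
    (hp : ∀ o, 0 < p o) (E : Obs 𝒲 Ys → Prop) (o : Obs 𝒲 Ys) (ho : E o) : 0 < prE p E := by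
  classical
  unfold prE
  refine Finset.sum_pos' (fun i _ => ?_) ⟨o, Finset.mem_univ _, ?_⟩
  · split_ifs
    · exact (hp i).le
    · exact le_rfl
  · rw [if_pos ho]; exact hp o

lemma aux_sumY {𝒲 : Type*} [Fintype 𝒲] {Ys : Finset ℝ} (q : Obs 𝒲 Ys → ℝ)
    (F : Obs 𝒲 Ys → Prop) :
    (∑ y : {y : ℝ // y ∈ Ys}, (y : ℝ) * condP q (fun o => oYs o = y) F) = condEY q F := by
  classical
  unfold condP condEY
  simp only [← mul_div_assoc]
  rw [← Finset.sum_div]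
  congr 1
  unfold prE
  simp only [Finset.mul_sum]
  rw [Finset.sum_comm]
  refine Finset.sum_congr rfl fun o _ => ?_
  by_cases h : F o
  · simp [h, oY, oYs]
  · simp [h]

open scoped Classical in
lemma aux_deriv {𝒲 : Type*} [Fintype 𝒲] {Ys : Finset ℝ} (p γ : Obs 𝒲 Ys → ℝ)
    (F : Obs 𝒲 Ys → Prop) (h0 : prE p F ≠ 0) :
    HasDerivAt (fun ε => condEY (pert p γ ε) F)
      (∑ o, if F o then γ o * (oY o - condEY p F) * p o / prE p F else 0) 0 := by
  have hN : HasDerivAt (fun ε : ℝ => ∑ o, if F o then oY o * pert p γ ε o else 0)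
      (∑ o, if F o then oY o * (γ o * p o) else 0) 0 := by
    refine HasDerivAt.fun_sum fun o _ => ?_
    split_ifs
    · unfold pert
      have := ((((hasDerivAt_id (0:ℝ)).mul_const (γ o)).const_add 1).mul_const (p o)).const_mul (oY o)
      simpa using this
    · exact hasDerivAt_const _ _
  have hD : HasDerivAt (fun ε : ℝ => prE (pert p γ ε) F)
      (∑ o, if F o then (γ o * p o) else 0) 0 := by
    unfold prE
    refine HasDerivAt.fun_sum fun o _ => ?_
    split_ifs
    · unfold pert
      have := ((((hasDerivAt_id (0:ℝ)).mul_const (γ o)).const_add 1).mul_const (p o))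
      simpa using this
    · exact hasDerivAt_const _ _
  have hp0 : pert p γ 0 = p := by funext o; simp [pert]
  have := hN.fun_div hD (by rw [hp0]; exact h0)
  unfold condEY at *
  refine this.congr_deriv ?_
  symm
  rw [hp0]
  set D := prE p F
  set N := ∑ o, if F o then oY o * p o else 0
  have : ∀ o, (if F o then γ o * (oY o - N / D) * p o / D else 0)
      = (if F o then oY o * (γ o * p o) else 0) / D
        - (if F o then γ o * p o else 0) * (N / D ^ 2) := by
    intro o
    split_ifs
    · field_simp
    · simp
  simp only [this]
  rw [Finset.sum_sub_distrib, ← Finset.sum_div, ← Finset.sum_mul]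
  field_simp

lemma aux_H {𝒲 : Type*} [Fintype 𝒲] {Ys : Finset ℝ} (p : Obs 𝒲 Ys → ℝ)
    (hp : ∀ o, 0 < p o) (gs : Fin 2 → 𝒲 → ℝ) (a z m : Fin 2) (w : 𝒲) (o : Obs 𝒲 Ys)
    (ho : oM o = m ∧ oZ o = z ∧ oA o = a ∧ oW o = w ∧ oS o = 1) :
    Hwt p gs a o = gs m w * pZ p a z w 0 * pWS0 p w /
      prE p (fun o => oM o = m ∧ oZ o = z ∧ oA o = a ∧ oW o = w ∧ oS o = 1) := by
  obtain ⟨h1, h2, h3, h4, h5⟩ := ho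
  unfold Hwt
  rw [h1, h2, h4, if_pos ⟨h5, h3⟩]
  generalize pZ p a z w 0 = c
  unfold pM pZ pA pSW pS0 pWS0 condP
  have e1 := (aux_prE_pos p hp (fun o => oM o = m ∧ oZ o = z ∧ oA o = a ∧ oW o = w ∧ oS o = 1) o
    ⟨h1, h2, h3, h4, h5⟩).ne'
  have e2 := (aux_prE_pos p hp (fun o => oZ o = z ∧ oA o = a ∧ oW o = w ∧ oS o = 1) o
    ⟨h2, h3, h4, h5⟩).ne'
  have e3 := (aux_prE_pos p hp (fun o => oA o = a ∧ oW o = w ∧ oS o = 1) o ⟨h3, h4, h5⟩).ne'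
  have e4 := (aux_prE_pos p hp (fun o => oW o = w ∧ oS o = 1) o ⟨h4, h5⟩).ne'
  have e5 := (aux_prE_pos p hp (fun o => oW o = w) o h4).ne'
  have e6 := (aux_prE_pos p hp (fun o => oS o = 0) (0, o.2) rfl).ne'
  have c1 : (fun o : Obs 𝒲 Ys => oS o = 1 ∧ oW o = w) = (fun o => oW o = w ∧ oS o = 1) := by
    funext o; exact propext and_comm
  have c0 : (fun o : Obs 𝒲 Ys => oS o = 0 ∧ oW o = w) = (fun o => oW o = w ∧ oS o = 0) := by
    funext o; exact propext and_comm
  rw [c1, c0]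
  field_simp

end TransportPMF

open TransportPMF Obs in
/-- Perturbing only the outcome-regression factor of the transported
estimand along the score path, the resulting map `φ_Y` is differentiable at `ε = 0`
with derivative `Σ_o γ(o) · D_Y(o) · p(o)`. -/
theorem pathwise_derivative_outcome_factor
    {𝒲 : Type*} [Fintype 𝒲] [Nonempty 𝒲] {Ys : Finset ℝ} (hYs : Ys.Nonempty)
    -- `p` is the (strictly positive) joint pmf of `O = (S, W, A, Z, M, Y)`
    (p : Obs 𝒲 Ys → ℝ) (hp_pos : ∀ o, 0 < p o) (hp_sum : ∑ o : Obs 𝒲 Ys, p o = 1)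
    (a : Fin 2)
    (gs : Fin 2 → 𝒲 → ℝ)
    (hgs_pos : ∀ (m : Fin 2) (w : 𝒲), 0 < gs m w ∧ gs m w < 1)
    (hgs_sum : ∀ w : 𝒲, gs 0 w + gs 1 w = 1)
    -- the score `γ`
    (γ : Obs 𝒲 Ys → ℝ) (hγ_mean : ∑ o : Obs 𝒲 Ys, γ o * p o = 0)
    (hγ_bdd : (⨆ o : Obs 𝒲 Ys, |γ o|) < 1)
    -- `φ_Y`: only the outcome-regression factor is perturbed along the score path
    (φY : ℝ → ℝ)
    (hφY : φY = fun ε : ℝ =>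
      ∑ w : 𝒲, ∑ z : Fin 2, ∑ m : Fin 2,
        (∑ y : {y : ℝ // y ∈ Ys}, (y : ℝ) *
          condP (pert p γ ε) (fun o => oYs o = y)
            (fun o => oM o = m ∧ oZ o = z ∧ oA o = a ∧ oW o = w ∧ oS o = 1)) *
        gs m w * pZ p a z w 0 * pWS0 p w) :
    HasDerivAt φY (∑ o : Obs 𝒲 Ys, γ o * DY p gs a o * p o) 0 := by
  classical
  have key : ∀ (w : 𝒲) (z m : Fin 2), HasDerivAt (fun ε : ℝ =>
      (∑ y : {y : ℝ // y ∈ Ys}, (y : ℝ) *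
          condP (pert p γ ε) (fun o => oYs o = y)
            (fun o => oM o = m ∧ oZ o = z ∧ oA o = a ∧ oW o = w ∧ oS o = 1)) *
        gs m w * pZ p a z w 0 * pWS0 p w)
      (∑ o : Obs 𝒲 Ys, if oM o = m ∧ oZ o = z ∧ oA o = a ∧ oW o = w ∧ oS o = 1 then
        γ o * DY p gs a o * p o else 0) 0 := by
    intro w z m
    obtain ⟨y, hy⟩ := hYs
    have hpos := (aux_prE_pos p hp_pos
      (fun o => oM o = m ∧ oZ o = z ∧ oA o = a ∧ oW o = w ∧ oS o = 1)
      (1, w, a, z, m, ⟨y, hy⟩) ⟨rfl, rfl, rfl, rfl, rfl⟩).ne'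
    simp only [aux_sumY]
    have h := (((aux_deriv p γ _ hpos).mul_const (gs m w)).mul_const (pZ p a z w 0)).mul_const
      (pWS0 p w)
    refine h.congr_deriv ?_
    symm
    simp only [Finset.sum_mul]
    refine Finset.sum_congr rfl fun o _ => ?_
    by_cases ho : oM o = m ∧ oZ o = z ∧ oA o = a ∧ oW o = w ∧ oS o = 1
    · rw [if_pos ho, if_pos ho]
      unfold DY
      rw [aux_H p hp_pos gs a z m w o ho]
      obtain ⟨h1, h2, h3, h4, h5⟩ := ho
      rw [h1, h2, h3, h4]
      unfold qbarY
      ring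
    · rw [if_neg ho, if_neg ho]; simp
  rw [hφY]
  have h := HasDerivAt.fun_sum (u := (Finset.univ : Finset 𝒲)) fun w _ =>
    HasDerivAt.fun_sum (u := (Finset.univ : Finset (Fin 2))) fun z _ =>
    HasDerivAt.fun_sum (u := (Finset.univ : Finset (Fin 2))) fun m _ => key w z m
  refine h.congr_deriv ?_
  symm
  have swap : ∀ f : 𝒲 → Fin 2 → Fin 2 → Obs 𝒲 Ys → ℝ,
      ∑ w, ∑ z, ∑ m, ∑ o, f w z m o = ∑ o, ∑ w, ∑ z, ∑ m, f w z m o := by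
    intro f
    rw [Finset.sum_comm (s := (Finset.univ : Finset (Obs 𝒲 Ys)))]
    refine Finset.sum_congr rfl fun w _ => ?_
    rw [Finset.sum_comm (s := (Finset.univ : Finset (Obs 𝒲 Ys)))]
    refine Finset.sum_congr rfl fun z _ => ?_
    rw [Finset.sum_comm (s := (Finset.univ : Finset (Obs 𝒲 Ys)))]
  rw [swap]
  refine Finset.sum_congr rfl fun o _ => ?_
  by_cases ho : oS o = 1 ∧ oA o = a
  · rw [Finset.sum_eq_single (oW o), Finset.sum_eq_single (oZ o), Finset.sum_eq_single (oM o)]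
    · rw [if_pos ⟨rfl, rfl, ho.2, rfl, ho.1⟩]
    · intro b _ hb
      rw [if_neg (fun h => hb h.1.symm)]
    · simp
    · intro b _ hb
      exact Finset.sum_eq_zero fun m _ => if_neg (fun h => hb h.2.1.symm)
    · simp
    · intro b _ hb
      exact Finset.sum_eq_zero fun z _ => Finset.sum_eq_zero fun m _ =>
        if_neg (fun h => hb h.2.2.2.1.symm)
    · simp
  · have : DY p gs a o = 0 := by unfold DY Hwt; rw [if_neg ho]; simp
    simp [this]
end
end

section
/- The IPTW influence curve IC := H·(Y − Ψ(P)) has mean zero, and its conditional centering recovers the Y-component of the efficient influence curve: for every ω ∈ Ω, IC(ω) − E[IC | M=M(ω), Z=Z(ω), A=A(ω), W=W(ω), S=S(ω)] = D_Y(ω). Consequently E_P[IC²] = E_P[D_Y²] + E_P[(E[IC | M, Z, A, W, S])²], and in particular the variance of the IPTW influence curve is at least the variance of the Y-component of the efficient influence curve: E_P[IC²] ≥ E_P[D_Y²]. -/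
open MeasureTheory

noncomputable section

namespace TransportSetup

section Helpers

variable {Ω : Type*} [MeasurableSpace Ω]
  {𝒲 : Type*} [MeasurableSpace 𝒲] [MeasurableSingletonClass 𝒲]
  [Fintype 𝒲] [Nonempty 𝒲]
variable (T : TransportSetup Ω 𝒲)

/-- The joint conditioning variable. -/
def XX (ω : Ω) : Fin 2 × Fin 2 × Fin 2 × 𝒲 × Fin 2 :=
  (T.M ω, T.Z ω, T.A ω, T.W ω, T.S ω)

lemma measXX : Measurable T.XX :=
  T.measM.prodMk (T.measZ.prodMk (T.measA.prodMk (T.measW.prodMk T.measS)))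

/-- A cell. -/
def cell (c : Fin 2 × Fin 2 × Fin 2 × 𝒲 × Fin 2) : Set Ω := T.XX ⁻¹' {c}

lemma measCell (c : Fin 2 × Fin 2 × Fin 2 × 𝒲 × Fin 2) : MeasurableSet (T.cell c) :=
  T.measXX (measurableSet_singleton c)

lemma cell_eq (m z x : Fin 2) (w : 𝒲) (s : Fin 2) :
    T.cell (m, z, x, w, s) =
      {ω | T.M ω = m ∧ T.Z ω = z ∧ T.A ω = x ∧ T.W ω = w ∧ T.S ω = s} := by
  ext ω
  simp [cell, XX]

lemma integ (φ : (Fin 2 × Fin 2 × Fin 2 × 𝒲 × Fin 2) → ℝ → ℝ) :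
    Integrable (fun ω => φ (T.XX ω) (T.Y ω)) T.P := by
  have := T.isProb
  have hm : Measurable (fun ω => (T.XX ω, (⟨T.Y ω, T.hY ω⟩ : T.ySet))) :=
    T.measXX.prodMk (T.measY.subtype_mk)
  have : IsFiniteMeasure (T.P.map (fun ω => (T.XX ω, (⟨T.Y ω, T.hY ω⟩ : T.ySet)))) :=
    inferInstance
  have h : Integrable (fun p : (Fin 2 × Fin 2 × Fin 2 × 𝒲 × Fin 2) × T.ySet => φ p.1 p.2.1)
    (T.P.map (fun ω => (T.XX ω, (⟨T.Y ω, T.hY ω⟩ : T.ySet)))) := Integrable.of_finite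
  exact h.comp_measurable hm

lemma pr_pos_of_cell (m z x : Fin 2) (w : 𝒲) (s : Fin 2) {E : Set Ω}
    (h : T.cell (m, z, x, w, s) ⊆ E) : 0 < T.pr E := by
  have := T.isProb
  obtain ⟨y, hy⟩ := T.ySet_nonempty
  refine ENNReal.toReal_pos (ne_of_gt ?_) (measure_ne_top _ _)
  refine lt_of_lt_of_le (T.positivity s x z m w y hy) (measure_mono ?_)
  refine subset_trans ?_ h
  rw [cell_eq]
  rintro ω ⟨h1, h2, h3, h4, h5, -⟩
  exact ⟨h5, h4, h3, h2, h1⟩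

lemma int_cells (f : Ω → ℝ) (hf : Integrable f T.P) :
    ∫ ω, f ω ∂T.P = ∑ c, ∫ ω in T.cell c, f ω ∂T.P := by
  rw [← integral_iUnion_fintype T.measCell _ (fun i => hf.integrableOn)]
  · have : (⋃ i, T.cell i) = Set.univ := by
      ext ω; simp [cell]
    rw [this, setIntegral_univ]
  · intro c d hcd
    refine Set.disjoint_left.2 fun ω h1 h2 => hcd ?_
    have h1' : T.XX ω = c := h1
    have h2' : T.XX ω = d := h2
    rw [← h1', h2']

lemma int_cell (k q : (Fin 2 × Fin 2 × Fin 2 × 𝒲 × Fin 2) → ℝ)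
    (c : Fin 2 × Fin 2 × Fin 2 × 𝒲 × Fin 2) :
    ∫ ω in T.cell c, k (T.XX ω) * (T.Y ω - q (T.XX ω)) ∂T.P
      = k c * ((∫ ω in T.cell c, T.Y ω ∂T.P) - q c * T.pr (T.cell c)) := by
  have := T.isProb
  have e : ∫ ω in T.cell c, k (T.XX ω) * (T.Y ω - q (T.XX ω)) ∂T.P
      = ∫ ω in T.cell c, k c * (T.Y ω - q c) ∂T.P := by
    refine setIntegral_congr_fun (T.measCell c) fun ω hω => ?_
    have : T.XX ω = c := hω
    simp only [this]
  rw [e, integral_const_mul, integral_sub (T.integ fun _ y => y).integrableOn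
    (integrable_const _)]
  simp [pr, Measure.real, mul_comm]

lemma int_cell_const (k : (Fin 2 × Fin 2 × Fin 2 × 𝒲 × Fin 2) → ℝ)
    (c : Fin 2 × Fin 2 × Fin 2 × 𝒲 × Fin 2) :
    ∫ ω in T.cell c, k (T.XX ω) ∂T.P = k c * T.pr (T.cell c) := by
  have := T.isProb
  have e : ∫ ω in T.cell c, k (T.XX ω) ∂T.P = ∫ ω in T.cell c, k c ∂T.P := by
    refine setIntegral_congr_fun (T.measCell c) fun ω hω => ?_
    have : T.XX ω = c := hω
    simp only [this]
  rw [e]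
  simp [pr, Measure.real, mul_comm]

lemma sum_cpr {α : Type*} [Fintype α] [MeasurableSpace α] [MeasurableSingletonClass α]
    (V : Ω → α) (hV : Measurable V) (F : Set Ω) (hF : T.pr F ≠ 0) :
    ∑ v, T.cpr {ω | V ω = v} F = 1 := by
  have := T.isProb
  have h := sum_measureReal_preimage_singleton (μ := T.P.restrict F) Finset.univ (f := V)
    (fun y _ => hV (measurableSet_singleton y))
  have h2 : ∀ v, (T.P.restrict F).real (V ⁻¹' {v}) = T.pr ({ω | V ω = v} ∩ F) := by
    intro v
    rw [measureReal_def, Measure.restrict_apply (hV (measurableSet_singleton v))]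
    rfl
  simp only [h2] at h
  simp only [cpr]
  rw [← Finset.sum_div, h, div_eq_one_iff_eq hF]
  simp [pr, Measure.real]

/-- Weight as a function of the cell. -/
def hw (gs : Fin 2 → 𝒲 → ℝ) (a : Fin 2) (c : Fin 2 × Fin 2 × Fin 2 × 𝒲 × Fin 2) : ℝ :=
  (gs c.1 c.2.2.2.1 * T.pZ a c.2.1 c.2.2.2.1 0 * T.pSW 0 c.2.2.2.1 *
    (if c.2.2.2.2 = 1 ∧ c.2.2.1 = a then (1 : ℝ) else 0)) /
  (T.pM c.1 c.2.1 a c.2.2.2.1 * T.pZ a c.2.1 c.2.2.2.1 1 * T.pA a c.2.2.2.1 1 *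
    T.pSW 1 c.2.2.2.1 * T.pS0)

/-- Outcome regression as a function of the cell. -/
def qc (c : Fin 2 × Fin 2 × Fin 2 × 𝒲 × Fin 2) : ℝ :=
  T.qbarY c.1 c.2.1 c.2.2.1 c.2.2.2.1

lemma hw_centered (gs : Fin 2 → 𝒲 → ℝ) (a : Fin 2)
    (c : Fin 2 × Fin 2 × Fin 2 × 𝒲 × Fin 2) :
    T.hw gs a c * ((∫ ω in T.cell c, T.Y ω ∂T.P) - T.qc c * T.pr (T.cell c)) = 0 := by
  obtain ⟨m, z, x, w, s⟩ := c
  by_cases hs : s = 1 ∧ x = a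
  · obtain ⟨rfl, rfl⟩ := hs
    have hp := T.pr_pos_of_cell m z x w 1 subset_rfl
    have : T.qc (m, z, x, w, 1) * T.pr (T.cell (m, z, x, w, 1))
        = ∫ ω in T.cell (m, z, x, w, 1), T.Y ω ∂T.P := by
      simp only [qc, qbarY, cexp, ← cell_eq]
      field_simp
    rw [this, sub_self, mul_zero]
  · simp [hw, hs]

lemma hw_pr (gs : Fin 2 → 𝒲 → ℝ) (a m z : Fin 2) (w : 𝒲) :
    T.hw gs a (m, z, a, w, 1) * T.pr (T.cell (m, z, a, w, 1))
      = T.pWS0 w * T.pZ a z w 0 * gs m w := by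
  have e1 : {ω | T.M ω = m} ∩ {ω | T.Z ω = z ∧ T.A ω = a ∧ T.W ω = w ∧ T.S ω = 1}
      = T.cell (m, z, a, w, 1) := by rw [cell_eq]; rfl
  have e2 : {ω | T.Z ω = z} ∩ {ω | T.A ω = a ∧ T.W ω = w ∧ T.S ω = 1}
      = {ω | T.Z ω = z ∧ T.A ω = a ∧ T.W ω = w ∧ T.S ω = 1} := rfl
  have e3 : {ω | T.A ω = a} ∩ {ω | T.W ω = w ∧ T.S ω = 1}
      = {ω | T.A ω = a ∧ T.W ω = w ∧ T.S ω = 1} := rfl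
  have e4 : {ω | T.S ω = 1} ∩ {ω | T.W ω = w} = {ω | T.W ω = w ∧ T.S ω = 1} := by
    ext ω; simp [and_comm]
  have e5 : {ω | T.S ω = 0} ∩ {ω | T.W ω = w} = {ω | T.W ω = w} ∩ {ω | T.S ω = 0} :=
    Set.inter_comm _ _
  have p1 : 0 < T.pr (T.cell (m, z, a, w, 1)) := T.pr_pos_of_cell m z a w 1 subset_rfl
  have p2 : 0 < T.pr {ω | T.Z ω = z ∧ T.A ω = a ∧ T.W ω = w ∧ T.S ω = 1} :=
    T.pr_pos_of_cell m z a w 1 (by rw [cell_eq]; intro ω h; exact h.2)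
  have p3 : 0 < T.pr {ω | T.A ω = a ∧ T.W ω = w ∧ T.S ω = 1} :=
    T.pr_pos_of_cell m z a w 1 (by rw [cell_eq]; intro ω h; exact h.2.2)
  have p4 : 0 < T.pr {ω | T.W ω = w ∧ T.S ω = 1} :=
    T.pr_pos_of_cell m z a w 1 (by rw [cell_eq]; intro ω h; exact h.2.2.2)
  have p5 : 0 < T.pr {ω | T.W ω = w} :=
    T.pr_pos_of_cell m z a w 1 (by rw [cell_eq]; intro ω h; exact h.2.2.2.1)
  have p6 : 0 < T.pr {ω | T.S ω = 0} :=
    T.pr_pos_of_cell m z a w 0 (by rw [cell_eq]; intro ω h; exact h.2.2.2.2)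
  have hZ : T.pZ a z w 1 = T.pr {ω | T.Z ω = z ∧ T.A ω = a ∧ T.W ω = w ∧ T.S ω = 1}
      / T.pr {ω | T.A ω = a ∧ T.W ω = w ∧ T.S ω = 1} := by rw [pZ, cpr, e2]
  simp only [hw, hZ, pM, pA, pSW, pS0, pWS0, cpr, e1, e3, e4, e5]
  generalize T.pZ a z w 0 = u0
  simp only [and_self, if_true]
  field_simp

lemma sum_weights (gs : Fin 2 → 𝒲 → ℝ) (hgs_sum : ∀ w : 𝒲, gs 0 w + gs 1 w = 1)
    (a : Fin 2) :
    ∑ w : 𝒲, ∑ z : Fin 2, ∑ m : Fin 2, T.pWS0 w * T.pZ a z w 0 * gs m w = 1 := by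
  have h1 : ∀ w, ∑ z : Fin 2, T.pZ a z w 0 = 1 := fun w =>
    T.sum_cpr T.Z T.measZ _ (ne_of_gt
      (T.pr_pos_of_cell 0 0 a w 0 (by rw [cell_eq]; intro ω h; exact h.2.2)))
  have h2 : ∑ w, T.pWS0 w = 1 := T.sum_cpr T.W T.measW _ (ne_of_gt
      (T.pr_pos_of_cell 0 0 a (Classical.arbitrary 𝒲) 0
        (by rw [cell_eq]; intro ω h; exact h.2.2.2.2)))
  have h3 : ∀ w, ∑ m : Fin 2, gs m w = 1 := fun w => by
    rw [Fin.sum_univ_two]; exact hgs_sum w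
  simp only [← Finset.mul_sum, h3, mul_one, h1, h2]

end Helpers

end TransportSetup

/-- The IPTW influence curve `IC := H·(Y − Ψ(P))` has mean zero,
its conditional centering recovers the `Y`-component of the efficient influence
curve, `E_P[IC²] = E_P[D_Y²] + E_P[(E[IC | M,Z,A,W,S])²]`, and in particular
`E_P[IC²] ≥ E_P[D_Y²]`. -/
theorem iptw_influence_curve_decomposition
    {Ω : Type*} [MeasurableSpace Ω]
    {𝒲 : Type*} [MeasurableSpace 𝒲] [MeasurableSingletonClass 𝒲]
    [Fintype 𝒲] [Nonempty 𝒲]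
    (T : TransportSetup Ω 𝒲) (a : Fin 2)
    (gs : Fin 2 → 𝒲 → ℝ)
    (hgs_pos : ∀ (m : Fin 2) (w : 𝒲), 0 < gs m w ∧ gs m w < 1)
    (hgs_sum : ∀ w : 𝒲, gs 0 w + gs 1 w = 1)
    -- `IC := H · (Y − Ψ(P))`
    (IC : Ω → ℝ) (hIC : IC = fun ω => T.Hwt gs a ω * (T.Y ω - T.Psi gs a))
    -- `condIC(ω) := E[IC | M=M(ω), Z=Z(ω), A=A(ω), W=W(ω), S=S(ω)]`
    (condIC : Ω → ℝ)
    (hcondIC : condIC = fun ω => T.cexp IC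
      {ω' | T.M ω' = T.M ω ∧ T.Z ω' = T.Z ω ∧ T.A ω' = T.A ω ∧
            T.W ω' = T.W ω ∧ T.S ω' = T.S ω}) :
    (∫ ω, IC ω ∂T.P) = 0 ∧
    (∀ ω : Ω, IC ω - condIC ω = T.DY gs a ω) ∧
    (∫ ω, (IC ω) ^ 2 ∂T.P) =
      (∫ ω, (T.DY gs a ω) ^ 2 ∂T.P) + (∫ ω, (condIC ω) ^ 2 ∂T.P) ∧
    (∫ ω, (T.DY gs a ω) ^ 2 ∂T.P) ≤ (∫ ω, (IC ω) ^ 2 ∂T.P) := by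
  have := T.isProb
  have hH : ∀ ω, T.Hwt gs a ω = T.hw gs a (T.XX ω) := fun ω => rfl
  have hDY : ∀ ω, T.DY gs a ω = T.hw gs a (T.XX ω) * (T.Y ω - T.qc (T.XX ω)) := by
    intro ω
    rw [← hH, mul_comm]; rfl
  have hIC' : ∀ ω, IC ω = T.hw gs a (T.XX ω) * (T.Y ω - T.Psi gs a) := by
    intro ω; rw [hIC]; rfl
  have hcond : ∀ ω, condIC ω = T.hw gs a (T.XX ω) * (T.qc (T.XX ω) - T.Psi gs a) := by
    intro ω
    have hp : 0 < T.pr (T.cell (T.XX ω)) := T.pr_pos_of_cell _ _ _ _ _ subset_rfl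
    have e : condIC ω = T.cexp IC (T.cell (T.XX ω)) := by
      rw [hcondIC, TransportSetup.XX, TransportSetup.cell_eq]
    have e2 := T.int_cell (T.hw gs a) (fun _ => T.Psi gs a) (T.XX ω)
    have e3 := T.hw_centered gs a (T.XX ω)
    rw [e, TransportSetup.cexp, div_eq_iff hp.ne']
    simp only [hIC']
    rw [e2]
    linarith
  -- orthogonality
  have horth : ∀ k : (Fin 2 × Fin 2 × Fin 2 × 𝒲 × Fin 2) → ℝ,
      ∫ ω, k (T.XX ω) * T.DY gs a ω ∂T.P = 0 := by
    intro k
    have e : (fun ω => k (T.XX ω) * T.DY gs a ω) = fun ω =>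
        (fun c => k c * T.hw gs a c) (T.XX ω) * (T.Y ω - T.qc (T.XX ω)) := by
      funext ω; rw [hDY]; ring
    rw [e, T.int_cells _ (T.integ fun c y => (k c * T.hw gs a c) * (y - T.qc c))]
    refine Finset.sum_eq_zero fun c _ => ?_
    rw [T.int_cell (fun c => k c * T.hw gs a c) T.qc c, mul_assoc, T.hw_centered, mul_zero]
  have hdec : ∀ ω, IC ω - condIC ω = T.DY gs a ω := by
    intro ω; rw [hIC', hcond, hDY]; ring
  have iDY : Integrable (fun ω => T.DY gs a ω) T.P := by
    simp only [hDY]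
    exact T.integ fun c y => T.hw gs a c * (y - T.qc c)
  have iDY2 : Integrable (fun ω => T.DY gs a ω ^ 2) T.P := by
    simp only [hDY]
    exact T.integ fun c y => (T.hw gs a c * (y - T.qc c)) ^ 2
  have ic : Integrable (fun ω => condIC ω) T.P := by
    simp only [hcond]
    exact T.integ fun c y => T.hw gs a c * (T.qc c - T.Psi gs a)
  have ic2 : Integrable (fun ω => condIC ω ^ 2) T.P := by
    simp only [hcond]
    exact T.integ fun c y => (T.hw gs a c * (T.qc c - T.Psi gs a)) ^ 2
  have ix : Integrable (fun ω => 2 * condIC ω * T.DY gs a ω) T.P := by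
    simp only [hcond, hDY]
    exact T.integ fun c y => 2 * (T.hw gs a c * (T.qc c - T.Psi gs a)) *
      (T.hw gs a c * (y - T.qc c))
  have hpyth : (∫ ω, (IC ω) ^ 2 ∂T.P) =
      (∫ ω, (T.DY gs a ω) ^ 2 ∂T.P) + (∫ ω, (condIC ω) ^ 2 ∂T.P) := by
    have e : (fun ω => IC ω ^ 2) = fun ω =>
        (T.DY gs a ω ^ 2 + condIC ω ^ 2) + 2 * condIC ω * T.DY gs a ω := by
      funext ω; rw [← hdec]; ring
    have ho : ∫ ω, 2 * condIC ω * T.DY gs a ω ∂T.P = 0 := by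
      simp only [hcond]
      exact horth fun c => 2 * (T.hw gs a c * (T.qc c - T.Psi gs a))
    have is : Integrable (fun ω => T.DY gs a ω ^ 2 + condIC ω ^ 2) T.P := iDY2.add ic2
    rw [e, integral_add is ix, ho, add_zero, integral_add iDY2 ic2]
  have hmean : ∫ ω, condIC ω ∂T.P = 0 := by
    rw [T.int_cells _ ic]
    simp only [hcond]
    simp only [T.int_cell_const (fun c => T.hw gs a c * (T.qc c - T.Psi gs a))]
    have key : ∀ m z x : Fin 2, ∀ w : 𝒲, ∀ s : Fin 2,
        T.hw gs a (m, z, x, w, s) * (T.qc (m, z, x, w, s) - T.Psi gs a) *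
          T.pr (T.cell (m, z, x, w, s)) =
        if s = 1 then if x = a then T.pWS0 w * T.pZ a z w 0 * gs m w *
          (T.qbarY m z a w - T.Psi gs a) else 0 else 0 := by
      intro m z x w s
      by_cases hs : s = 1
      · by_cases hx : x = a
        · subst hs hx
          rw [if_pos rfl, if_pos rfl, ← T.hw_pr gs x m z w]
          simp only [TransportSetup.qc]
          ring
        · simp [TransportSetup.hw, hx]
      · simp [TransportSetup.hw, hs]
    simp only [Fintype.sum_prod_type, key, Finset.sum_ite_eq', Finset.mem_univ, if_true]
    have sw : ∀ f : Fin 2 → Fin 2 → 𝒲 → ℝ,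
        ∑ m, ∑ z, ∑ x : Fin 2, ∑ w, (if x = a then f m z w else 0)
          = ∑ w, ∑ z, ∑ m, f m z w := by
      intro f
      have h1 : ∀ m z, ∑ x : Fin 2, ∑ w, (if x = a then f m z w else 0) = ∑ w, f m z w := by
        intro m z
        rw [Finset.sum_comm]
        simp
      simp only [h1, Fin.sum_univ_two, Finset.sum_add_distrib]
      ring
    rw [sw fun m z w => T.pWS0 w * T.pZ a z w 0 * gs m w * (T.qbarY m z a w - T.Psi gs a)]
    simp only [mul_sub, Finset.sum_sub_distrib, ← Finset.sum_mul]
    rw [T.sum_weights gs hgs_sum a, one_mul, sub_eq_zero]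
    rfl
  refine ⟨?_, hdec, hpyth, ?_⟩
  · have e : (fun ω => IC ω) = fun ω => T.DY gs a ω + condIC ω := by
      funext ω; rw [← hdec]; ring
    have h0 := horth fun _ => 1
    simp only [one_mul] at h0
    rw [e, integral_add iDY ic, h0, hmean, add_zero]
  · rw [hpyth]
    have : 0 ≤ ∫ ω, (condIC ω) ^ 2 ∂T.P := integral_nonneg fun ω => sq_nonneg _
    linarith
end
end
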